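/- Fix privacy parameters ε_1,…,ε_n > 0, λ > 0, and set B(λ) = min(1/√λ, √d/λ), w_i = ε_i / Σ_{j=1}^n ε_j for each i, and η = (λ / (2√d·(1 + √d·B(λ)))) · Σ_{j=1}^n ε_j. Fix an index i and let D = ((x_1,y_1),…,(x_n,y_n)) and D' = ((x_1',y_1'),…,(x_n',y_n')) be two datasets with x_j, x_j' ∈ [0,1]^d and y_j, y_j' ∈ [−1,1] for all j, agreeing at every index j ≠ i. Let θ̄ and θ̄' be the global minimizers over ℝ^d of the weighted ridge losses (with weights w) of D and D' respectively. Then for every o ∈ ℝ^d, exp(−η‖o − θ̄‖₂) ≤ exp(ε_i) · exp(−η‖o − θ̄'‖₂). (This is the pointwise density inequality showing that the output-perturbation mechanism θ̂ = θ̄ + Z, with Z having density proportional to exp(−η‖z‖₂), is ε_i-differentially private with respect to data point i.) -/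

import Mathlib

open scoped InnerProductSpace BigOperators

section WeightedRidge

variable {E ι : Type*} [NormedAddCommGroup E] [InnerProductSpace ℝ E] [Fintype ι]

/-- The weighted ridge loss. -/
def weightedRidgeLoss (w : ι → ℝ) (lam : ℝ) (x : ι → E) (y : ι → ℝ) (θ : E) : ℝ :=
  (∑ j, w j * (y j - ⟪θ, x j⟫_ℝ) ^ 2) + lam * ‖θ‖ ^ 2

variable {w : ι → ℝ} {lam : ℝ} {x : ι → E} {y : ι → ℝ} {θ : E}

theorem weightedRidgeLoss_add_smul (v : E) (t : ℝ) :
    weightedRidgeLoss w lam x y (θ + t • v) = weightedRidgeLoss w lam x y θ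
      + 2 * (lam * ⟪θ, v⟫_ℝ - ∑ j, w j * (y j - ⟪θ, x j⟫_ℝ) * ⟪v, x j⟫_ℝ) * t
      + (∑ j, w j * ⟪v, x j⟫_ℝ ^ 2 + lam * ‖v‖ ^ 2) * (t * t) := by
  have hsum : ∑ j, w j * (y j - ⟪θ + t • v, x j⟫_ℝ) ^ 2
      = ∑ j, w j * (y j - ⟪θ, x j⟫_ℝ) ^ 2
        - 2 * t * (∑ j, w j * (y j - ⟪θ, x j⟫_ℝ) * ⟪v, x j⟫_ℝ)
        + t * t * ∑ j, w j * ⟪v, x j⟫_ℝ ^ 2 := by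
    rw [Finset.mul_sum, Finset.mul_sum, ← Finset.sum_sub_distrib, ← Finset.sum_add_distrib]
    refine Finset.sum_congr rfl fun j _ => ?_
    rw [inner_add_left, real_inner_smul_left]
    ring
  have hnorm : ‖θ + t • v‖ ^ 2 = ‖θ‖ ^ 2 + 2 * t * ⟪θ, v⟫_ℝ + t * t * ‖v‖ ^ 2 := by
    rw [norm_add_sq_real, real_inner_smul_right, norm_smul, mul_pow, Real.norm_eq_abs, sq_abs]
    ring
  rw [weightedRidgeLoss, weightedRidgeLoss, hsum, hnorm]
  ring

/-- First-order optimality condition for the weighted ridge loss. -/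
theorem weightedRidgeLoss_normal_equation
    (hmin : ∀ θ', weightedRidgeLoss w lam x y θ ≤ weightedRidgeLoss w lam x y θ') (v : E) :
    lam * ⟪θ, v⟫_ℝ = ∑ j, w j * (y j - ⟪θ, x j⟫_ℝ) * ⟪v, x j⟫_ℝ := by
  have h := discrim_le_zero (a := ∑ j, w j * ⟪v, x j⟫_ℝ ^ 2 + lam * ‖v‖ ^ 2)
    (b := 2 * (lam * ⟪θ, v⟫_ℝ - ∑ j, w j * (y j - ⟪θ, x j⟫_ℝ) * ⟪v, x j⟫_ℝ)) (c := 0)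
    fun t => by
      have := hmin (θ + t • v)
      rw [weightedRidgeLoss_add_smul] at this
      linarith
  rw [discrim, mul_zero, sub_zero] at h
  have := pow_eq_zero_iff two_ne_zero |>.mp (le_antisymm h (sq_nonneg _))
  linarith

theorem norm_le_of_weightedRidgeLoss_min {R : ℝ} (hw : ∀ j, 0 ≤ w j) (hw1 : ∑ j, w j = 1)
    (hlam : 0 < lam) (hx : ∀ j, ‖x j‖ ≤ R) (hy : ∀ j, |y j| ≤ 1)
    (hmin : ∀ θ', weightedRidgeLoss w lam x y θ ≤ weightedRidgeLoss w lam x y θ') :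
    ‖θ‖ ≤ min (1 / √lam) (R / lam) := by
  refine le_min ?_ ?_
  · have h0 := hmin 0
    have hfit : 0 ≤ ∑ j, w j * (y j - ⟪θ, x j⟫_ℝ) ^ 2 :=
      Finset.sum_nonneg fun j _ => mul_nonneg (hw j) (sq_nonneg _)
    have hzero : ∑ j, w j * y j ^ 2 ≤ 1 := by
      rw [← hw1]
      exact Finset.sum_le_sum fun j _ =>
        mul_le_of_le_one_right (hw j) ((sq_le_one_iff_abs_le_one _).mpr (hy j))
    simp only [weightedRidgeLoss, inner_zero_left, sub_zero, norm_zero] at h0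
    rw [le_div_iff₀ (Real.sqrt_pos.mpr hlam)]
    refine abs_le_of_sq_le_sq' ?_ zero_le_one |>.2
    rw [mul_pow, Real.sq_sqrt hlam.le]
    linarith
  · rw [le_div_iff₀ hlam]
    have hself := weightedRidgeLoss_normal_equation hmin θ
    rw [real_inner_self_eq_norm_sq] at hself
    have hle : ∑ j, w j * (y j - ⟪θ, x j⟫_ℝ) * ⟪θ, x j⟫_ℝ ≤ R * ‖θ‖ := by
      calc _ ≤ ∑ j, w j * (R * ‖θ‖) := by
            refine Finset.sum_le_sum fun j _ => ?_
            rw [mul_assoc]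
            refine mul_le_mul_of_nonneg_left ?_ (hw j)
            have h1 : |⟪θ, x j⟫_ℝ| ≤ R * ‖θ‖ := by
              rw [mul_comm]
              exact (abs_real_inner_le_norm _ _).trans
                (mul_le_mul_of_nonneg_left (hx j) (norm_nonneg _))
            have h2 : y j * ⟪θ, x j⟫_ℝ ≤ |⟪θ, x j⟫_ℝ| :=
              (le_abs_self _).trans
                (abs_mul (y j) _ ▸ mul_le_of_le_one_left (abs_nonneg _) (hy j))
            nlinarith [sq_nonneg ⟪θ, x j⟫_ℝ]
        _ = R * ‖θ‖ := by rw [← Finset.sum_mul, hw1, one_mul]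
    rcases (norm_nonneg θ).eq_or_lt with h | h
    · rw [← h, zero_mul]
      by_contra! hR
      obtain ⟨j, -⟩ : (Finset.univ : Finset ι).Nonempty := by
        by_contra hne
        rw [Finset.not_nonempty_iff_eq_empty.mp hne, Finset.sum_empty] at hw1
        exact zero_ne_one hw1
      exact absurd ((norm_nonneg _).trans (hx j)) hR.not_ge
    · nlinarith

/-- Sensitivity of the weighted ridge minimizer to a change of one data point. -/
theorem norm_sub_le_of_weightedRidgeLoss_min {x' : ι → E} {y' : ι → ℝ} {θ' : E} {R B : ℝ} (i : ι)
    (hw : ∀ j, 0 ≤ w j) (hR : 0 ≤ R)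
    (hxi : ‖x i‖ ≤ R) (hxi' : ‖x' i‖ ≤ R) (hyi : |y i| ≤ 1) (hyi' : |y' i| ≤ 1)
    (hneighbor : ∀ j, j ≠ i → x j = x' j ∧ y j = y' j) (hB : ‖θ'‖ ≤ B)
    (hmin : ∀ θ₀, weightedRidgeLoss w lam x y θ ≤ weightedRidgeLoss w lam x y θ₀)
    (hmin' : ∀ θ₀, weightedRidgeLoss w lam x' y' θ' ≤ weightedRidgeLoss w lam x' y' θ₀) :
    lam * ‖θ - θ'‖ ≤ w i * (2 * R * (1 + R * B)) := by
  have hterm : ∀ (u v : E) (b : ℝ), ‖u‖ ≤ R → |b| ≤ 1 →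
      |(b - ⟪θ', u⟫_ℝ) * ⟪v, u⟫_ℝ| ≤ (1 + R * B) * (R * ‖v‖) := fun u v b hu hb => by
    rw [abs_mul]
    have h1 : |⟪θ', u⟫_ℝ| ≤ R * B := by
      rw [mul_comm]
      exact (abs_real_inner_le_norm _ _).trans
        (mul_le_mul hB hu (norm_nonneg _) ((norm_nonneg _).trans hB))
    have h2 : |⟪v, u⟫_ℝ| ≤ R * ‖v‖ := by
      rw [mul_comm]
      exact (abs_real_inner_le_norm _ _).trans (mul_le_mul_of_nonneg_left hu (norm_nonneg _))
    refine mul_le_mul ((abs_sub _ _).trans (add_le_add hb h1)) h2 (abs_nonneg _) ?_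
    have := abs_nonneg ⟪θ', u⟫_ℝ
    linarith
  set v := θ - θ' with hv
  have h := weightedRidgeLoss_normal_equation hmin v
  have h' := weightedRidgeLoss_normal_equation hmin' v
  have hdiff : lam * ‖v‖ ^ 2 = lam * ⟪θ, v⟫_ℝ - lam * ⟪θ', v⟫_ℝ := by
    rw [← mul_sub, ← inner_sub_left, ← hv, real_inner_self_eq_norm_sq]
  have hsum : lam * ⟪θ, v⟫_ℝ - lam * ⟪θ', v⟫_ℝ + ∑ j, w j * ⟪v, x j⟫_ℝ ^ 2
      = w i * ((y i - ⟪θ', x i⟫_ℝ) * ⟪v, x i⟫_ℝ - (y' i - ⟪θ', x' i⟫_ℝ) * ⟪v, x' i⟫_ℝ) := by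
    rw [h, h', ← Finset.sum_sub_distrib, ← Finset.sum_add_distrib, Finset.sum_eq_single i]
    · have : ⟪v, x i⟫_ℝ = ⟪θ, x i⟫_ℝ - ⟪θ', x i⟫_ℝ := by rw [hv, inner_sub_left]
      rw [this]
      ring
    · intro j _ hj
      obtain ⟨hxj, hyj⟩ := hneighbor j hj
      have : ⟪v, x' j⟫_ℝ = ⟪θ, x' j⟫_ℝ - ⟪θ', x' j⟫_ℝ := by rw [hv, inner_sub_left]
      rw [hxj, hyj, this]
      ring
    · exact fun hi => absurd (Finset.mem_univ i) hi
  have hpsd : 0 ≤ ∑ j, w j * ⟪v, x j⟫_ℝ ^ 2 :=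
    Finset.sum_nonneg fun j _ => mul_nonneg (hw j) (sq_nonneg _)
  have hbound : (y i - ⟪θ', x i⟫_ℝ) * ⟪v, x i⟫_ℝ - (y' i - ⟪θ', x' i⟫_ℝ) * ⟪v, x' i⟫_ℝ
      ≤ 2 * R * (1 + R * B) * ‖v‖ := by
    have h1 := (abs_le.mp (hterm (x i) v (y i) hxi hyi)).2
    have h2 := (abs_le.mp (hterm (x' i) v (y' i) hxi' hyi')).1
    linarith
  have hmain : lam * ‖v‖ * ‖v‖ ≤ w i * (2 * R * (1 + R * B)) * ‖v‖ := by
    have := mul_le_mul_of_nonneg_left hbound (hw i)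
    nlinarith
  have hB0 : 0 ≤ B := (norm_nonneg _).trans hB
  rcases (norm_nonneg v).eq_or_lt with h0 | h0
  · rw [← h0, mul_zero]
    have := hw i
    positivity
  · exact le_of_mul_le_mul_right hmain h0

end WeightedRidge

theorem EuclideanSpace.norm_le_sqrt_of_mem_Icc {d : ℕ} {u : EuclideanSpace ℝ (Fin d)}
    (hu : ∀ k, u k ∈ Set.Icc (0 : ℝ) 1) : ‖u‖ ≤ √d := by
  rw [EuclideanSpace.norm_eq]
  refine Real.sqrt_le_sqrt ?_
  calc ∑ k, ‖u k‖ ^ 2 ≤ ∑ _k : Fin d, (1 : ℝ) := by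
        refine Finset.sum_le_sum fun k _ => ?_
        rw [Real.norm_eq_abs, sq_abs]
        exact pow_le_one₀ (hu k).1 (hu k).2
    _ = d := by simp

/-- pointwise density inequality showing that PDP-OP with weights
`wᵢ = εᵢ/Σⱼεⱼ` and noise parameter `η = λ/(2√d(1+√d B(λ))) · Σⱼεⱼ` is `εᵢ`-personalized DP
with respect to data point `i`, where `B(λ) = min(1/√λ, √d/λ)`. -/
theorem pdp_op_pointwise_density_inequality
    {d n : ℕ} (ε : Fin n → ℝ) (hε : ∀ j, 0 < ε j) (lam : ℝ) (hlam : 0 < lam)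
    (Blam : ℝ) (hBlam : Blam = min (1 / Real.sqrt lam) (Real.sqrt d / lam))
    (w : Fin n → ℝ) (hwdef : ∀ j, w j = ε j / ∑ k, ε k)
    (η : ℝ)
    (hηdef : η = lam / (2 * Real.sqrt d * (1 + Real.sqrt d * Blam)) * ∑ k, ε k)
    (i : Fin n)
    (x x' : Fin n → EuclideanSpace ℝ (Fin d)) (y y' : Fin n → ℝ)
    (hx : ∀ j k, x j k ∈ Set.Icc (0 : ℝ) 1) (hx' : ∀ j k, x' j k ∈ Set.Icc (0 : ℝ) 1)
    (hy : ∀ j, y j ∈ Set.Icc (-1 : ℝ) 1) (hy' : ∀ j, y' j ∈ Set.Icc (-1 : ℝ) 1)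
    (hneighbor : ∀ j, j ≠ i → x j = x' j ∧ y j = y' j)
    (θbar θbar' : EuclideanSpace ℝ (Fin d))
    (hmin : ∀ θ : EuclideanSpace ℝ (Fin d),
      (∑ j, w j * (y j - ⟪θbar, x j⟫_ℝ) ^ 2) + lam * ‖θbar‖ ^ 2 ≤
      (∑ j, w j * (y j - ⟪θ, x j⟫_ℝ) ^ 2) + lam * ‖θ‖ ^ 2)
    (hmin' : ∀ θ : EuclideanSpace ℝ (Fin d),
      (∑ j, w j * (y' j - ⟪θbar', x' j⟫_ℝ) ^ 2) + lam * ‖θbar'‖ ^ 2 ≤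
      (∑ j, w j * (y' j - ⟪θ, x' j⟫_ℝ) ^ 2) + lam * ‖θ‖ ^ 2) :
    ∀ o : EuclideanSpace ℝ (Fin d),
      Real.exp (-η * ‖o - θbar‖) ≤ Real.exp (ε i) * Real.exp (-η * ‖o - θbar'‖) := by
  intro o
  have hS : 0 < ∑ k, ε k := Finset.sum_pos (fun k _ => hε k) ⟨i, Finset.mem_univ i⟩
  have hw : ∀ j, 0 ≤ w j := fun j => hwdef j ▸ (div_pos (hε j) hS).le
  have hw1 : ∑ j, w j = 1 := by
    simp_rw [hwdef, ← Finset.sum_div]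
    exact div_self hS.ne'
  have hB : ‖θbar'‖ ≤ Blam := hBlam ▸
    norm_le_of_weightedRidgeLoss_min hw hw1 hlam
      (fun j => EuclideanSpace.norm_le_sqrt_of_mem_Icc (hx' j))
      (fun j => abs_le.mpr (hy' j)) hmin'
  have hB0 : 0 ≤ Blam := (norm_nonneg _).trans hB
  have hsens := norm_sub_le_of_weightedRidgeLoss_min i hw (Real.sqrt_nonneg d)
    (EuclideanSpace.norm_le_sqrt_of_mem_Icc (hx i)) (EuclideanSpace.norm_le_sqrt_of_mem_Icc (hx' i))
    (abs_le.mpr (hy i)) (abs_le.mpr (hy' i)) hneighbor hB hmin hmin'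
  have hη : 0 ≤ η := by rw [hηdef]; positivity
  have hηsens : η * ‖θbar - θbar'‖ ≤ ε i := by
    set C := 2 * √(d : ℝ) * (1 + √(d : ℝ) * Blam)
    have hC : 0 ≤ C := by positivity
    calc η * ‖θbar - θbar'‖ = lam * ‖θbar - θbar'‖ * ((∑ k, ε k) / C) := by rw [hηdef]; ring
      _ ≤ w i * C * ((∑ k, ε k) / C) := mul_le_mul_of_nonneg_right hsens (by positivity)
      _ = ε i * (C / C) := by
        rw [hwdef]
        field_simp
      _ ≤ ε i := mul_le_of_le_one_right (hε i).le (div_self_le_one C)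
  rw [← Real.exp_add, Real.exp_le_exp]
  have htri : ‖o - θbar'‖ ≤ ‖o - θbar‖ + ‖θbar - θbar'‖ :=
    norm_sub_le_norm_sub_add_norm_sub o θbar θbar'
  have := mul_le_mul_of_nonneg_left htri hη
  linarith
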